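/- If X is a nonempty compact Hausdorff topological space of countable tightness, then there exists a point x ∈ X whose character is at most 2^ℵ₀; that is, x has a neighborhood basis of cardinality at most the continuum. -/

import Mathlib

open Cardinal Topology

/-- In a compact space, a family of neighborhoods of `x` of size at most the continuum whose
intersection is `{x}` yields a neighborhood basis of size at most the continuum. -/
theorem exists_nhds_basis_of_sInter {X : Type*} [TopologicalSpace X] [CompactSpace X] [T2Space X]
    (x : X) (P : Set (Set X)) (hcard : #P ≤ 2 ^ ℵ₀) (hP : ∀ U ∈ P, U ∈ 𝓝 x)
    (hinter : ∀ y, y ≠ x → ∃ U ∈ P, y ∉ U) :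
    ∃ B : Set (Set X), #B ≤ 2 ^ ℵ₀ ∧
      (∀ s ∈ B, s ∈ 𝓝 x) ∧ (∀ s ∈ 𝓝 x, ∃ t ∈ B, t ⊆ s) := by
  have hclosed : ∀ U : P, ∃ C ∈ 𝓝 x, IsClosed C ∧ C ⊆ U.1 := fun U =>
    exists_mem_nhds_isClosed_subset (hP U.1 U.2)
  choose C hCx hCc hCU using hclosed
  refine ⟨Set.range fun F : Finset P => ⋂ U ∈ F, C U, ?_, ?_, ?_⟩
  · refine mk_range_le.trans ?_
    cases finite_or_infinite P
    · exact (lt_aleph0_of_finite _).le.trans (cantor ℵ₀).le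
    · rwa [mk_finset_of_infinite]
  · rintro _ ⟨F, rfl⟩
    exact (Filter.biInter_finset_mem F).2 fun U _ => hCx U
  · intro s hs
    obtain ⟨F, hF⟩ := isOpen_interior.isClosed_compl.isCompact.elim_finite_subfamily_closed
      (s := (interior s)ᶜ) C hCc (by
        rw [← Set.disjoint_iff_inter_eq_empty, Set.disjoint_left]
        intro y hy hyC
        have hyx : y ≠ x := by
          rintro rfl
          exact hy (mem_interior_iff_mem_nhds.2 hs)
        obtain ⟨U, hU, hyU⟩ := hinter y hyx
        exact hyU (hCU ⟨U, hU⟩ (Set.mem_iInter.1 hyC _)))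
    refine ⟨_, ⟨F, rfl⟩, fun y hy => ?_⟩
    by_contra hys
    have : y ∈ (interior s)ᶜ ∩ ⋂ U ∈ F, C U := ⟨fun h => hys (interior_subset h), hy⟩
    rw [hF] at this
    exact this

/-- A point of a `Gδ` set contained in the closure of a countable set has character at most
the continuum. -/
theorem exists_nhds_basis_of_isGδ_subset_closure {X : Type*} [TopologicalSpace X] [CompactSpace X]
    [T2Space X] {S H : Set X} (hS : S.Countable) (hH : IsGδ H) (hHS : H ⊆ closure S)
    {x : X} (hx : x ∈ H) :
    ∃ B : Set (Set X), #B ≤ 2 ^ ℵ₀ ∧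
      (∀ s ∈ B, s ∈ 𝓝 x) ∧ (∀ s ∈ 𝓝 x, ∃ t ∈ B, t ⊆ s) := by
  obtain ⟨T, hTo, hTc, rfl⟩ := hH
  refine exists_nhds_basis_of_sInter x
    (T ∪ {U | U ∈ (fun A => (closure A)ᶜ) '' 𝒫 S ∧ x ∈ U}) ?_ ?_ ?_
  · refine (mk_union_le _ _).trans (add_le_of_le (cantor ℵ₀).le ?_ ?_)
    · exact hTc.le_aleph0.trans (cantor ℵ₀).le
    · refine (mk_le_mk_of_subset fun U hU => hU.1).trans (mk_image_le.trans ?_)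
      rw [mk_powerset]
      exact power_le_power_left two_ne_zero hS.le_aleph0
  · rintro U (hU | ⟨⟨A, -, rfl⟩, hxU⟩)
    · exact (hTo U hU).mem_nhds (hx U hU)
    · exact isClosed_closure.isOpen_compl.mem_nhds hxU
  · intro y hyx
    by_cases hy : y ∈ ⋂₀ T
    · obtain ⟨V, W, hV, hW, hyV, hxW, hVW⟩ := t2_separation hyx
      refine ⟨(closure (V ∩ S))ᶜ, Or.inr ⟨⟨_, Set.inter_subset_right, rfl⟩, fun hxV => ?_⟩,
        fun h => h (hV.inter_closure ⟨hyV, hHS hy⟩)⟩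
      obtain ⟨z, hzW, hzV, -⟩ := mem_closure_iff.1 hxV W hW hxW
      exact Set.disjoint_left.1 hVW hzV hzW
    · obtain ⟨U, hU, hyU⟩ : ∃ U ∈ T, y ∉ U := by simpa using hy
      exact ⟨U, Or.inl hU, hyU⟩

/-- In a normal space, a point of a closed `Gδ` set `H` outside a closed set `D` lies in a closed
`Gδ` subset of `H` disjoint from `D`. -/
theorem exists_isClosed_isGδ_disjoint {X : Type*} [TopologicalSpace X] [NormalSpace X] [T1Space X]
    {H D : Set X} (hHc : IsClosed H) (hHδ : IsGδ H) (hD : IsClosed D) {p : X} (hpH : p ∈ H)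
    (hpD : p ∉ D) : ∃ K ⊆ H, IsClosed K ∧ IsGδ K ∧ p ∈ K ∧ Disjoint K D := by
  obtain ⟨f, hf0, hf1, -⟩ := exists_continuous_zero_one_of_isClosed
    (isClosed_singleton (x := p)) hD (Set.disjoint_singleton_left.2 hpD)
  refine ⟨H ∩ f ⁻¹' {0}, Set.inter_subset_left, hHc.inter (isClosed_singleton.preimage f.continuous),
    hHδ.inter ((isClosed_singleton (x := (0 : ℝ))).isGδ.preimage f.continuous),
    ⟨hpH, hf0 rfl⟩, Set.disjoint_left.2 fun y hy hyD => ?_⟩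
  have h0 : f y = 0 := hy.2
  have h1 : f y = 1 := hf1 hyD
  exact zero_ne_one (h0.symm.trans h1)

/-- There is an uncountable well-order all of whose proper initial segments are countable. -/
theorem exists_uncountable_wellOrder_countable_Iio :
    ∃ (W : Type) (_ : LinearOrder W) (_ : WellFoundedLT W), Uncountable W ∧
      ∀ a : W, (Set.Iio a).Countable := by
  refine ⟨(ℵ₁ : Cardinal.{0}).ord.ToType, inferInstance, inferInstance, ?_, fun a => ?_⟩
  · rw [← aleph0_lt_mk_iff, mk_ord_toType]
    exact aleph0_lt_aleph_one
  · rw [← le_aleph0_iff_set_countable, ← lt_aleph_one_iff]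
    simpa using mk_Iio_lt a (by simp)

/-- If every closed nonempty `Gδ` set escapes the closure of every countable set, then there is a
sequence of points and a decreasing sequence of closed sets witnessing its freeness, along any
well-order with countable initial segments. -/
theorem exists_free_sequence {X : Type*} [TopologicalSpace X] [CompactSpace X] [T2Space X]
    [Nonempty X]
    (hesc : ∀ S H : Set X, S.Countable → IsClosed H → IsGδ H → H.Nonempty → ¬ H ⊆ closure S)
    {W : Type} [LinearOrder W] [WellFoundedLT W] (hW : ∀ a : W, (Set.Iio a).Countable) :
    ∃ (x : W → X) (K : W → Set X), (∀ a, IsClosed (K a)) ∧ (∀ a b, a ≤ b → x b ∈ K a) ∧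
      ∀ a, Disjoint (K a) (closure (x '' Set.Iio a)) := by
  have hstep : ∀ S H : Set X, ∃ q : X × Set X, S.Countable → IsClosed H → IsGδ H → H.Nonempty →
      q.2 ⊆ H ∧ IsClosed q.2 ∧ IsGδ q.2 ∧ q.1 ∈ q.2 ∧ Disjoint q.2 (closure S) := by
    intro S H
    by_cases h : S.Countable ∧ IsClosed H ∧ IsGδ H ∧ H.Nonempty
    · obtain ⟨hS, hHc, hHδ, hHn⟩ := h
      obtain ⟨p, hpH, hpS⟩ := Set.not_subset.1 (hesc S H hS hHc hHδ hHn)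
      obtain ⟨K, hK⟩ := exists_isClosed_isGδ_disjoint hHc hHδ isClosed_closure hpH hpS
      exact ⟨(p, K), fun _ _ _ _ => hK⟩
    · exact ⟨(Classical.arbitrary X, ∅), fun h₁ h₂ h₃ h₄ => (h ⟨h₁, h₂, h₃, h₄⟩).elim⟩
  choose g hg using hstep
  let F : W → X × Set X := (wellFounded_lt (α := W)).fix fun a f =>
    g (Set.range fun b : Set.Iio a => (f b.1 b.2).1) (⋂ b : Set.Iio a, (f b.1 b.2).2)
  have hF : ∀ a, F a = g (Set.range fun b : Set.Iio a => (F b.1).1)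
      (⋂ b : Set.Iio a, (F b.1).2) := fun a => WellFounded.fix_eq _ _ a
  have key : ∀ a, (F a).2 ⊆ (⋂ b : Set.Iio a, (F b.1).2) ∧ IsClosed (F a).2 ∧ IsGδ (F a).2 ∧
      (F a).1 ∈ (F a).2 ∧ Disjoint (F a).2 (closure (Set.range fun b : Set.Iio a => (F b.1).1)) := by
    intro a
    induction a using WellFoundedLT.induction with
    | ind a ih =>
      have := (hW a).to_subtype
      rw [hF a]
      refine hg _ _ (Set.countable_range _) (isClosed_iInter fun b => (ih b.1 b.2).2.1)
        (IsGδ.iInter fun b => (ih b.1 b.2).2.2.1) ?_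
      cases isEmpty_or_nonempty (Set.Iio a)
      · simp
      · refine IsCompact.nonempty_iInter_of_directed_nonempty_isCompact_isClosed _ ?_
          (fun b => ⟨_, (ih b.1 b.2).2.2.2.1⟩) (fun b => (ih b.1 b.2).2.1.isCompact)
          (fun b => (ih b.1 b.2).2.1)
        refine directed_of_isDirected_le fun b c hbc => ?_
        rcases hbc.eq_or_lt with rfl | hlt
        · exact subset_rfl
        · exact fun y hy => Set.mem_iInter.1 ((ih c.1 c.2).1 hy) ⟨b.1, hlt⟩
  refine ⟨fun a => (F a).1, fun a => (F a).2, fun a => (key a).2.1, fun a b hab => ?_, fun a => ?_⟩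
  · rcases hab.eq_or_lt with rfl | hlt
    · exact (key a).2.2.2.1
    · exact Set.mem_iInter.1 ((key b).1 (key b).2.2.2.1) ⟨a, hlt⟩
  · rw [Set.image_eq_range]
    exact (key a).2.2.2.2

/-- A nonempty compact Hausdorff space of countable tightness has a nonempty closed `Gδ` subset
contained in the closure of a countable set. -/
theorem exists_isGδ_subset_closure_countable {X : Type*} [TopologicalSpace X] [CompactSpace X]
    [T2Space X] [Nonempty X]
    (tight : ∀ (A : Set X) (x : X), x ∈ closure A →
      ∃ B ⊆ A, B.Countable ∧ x ∈ closure B) :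
    ∃ S H : Set X, S.Countable ∧ IsClosed H ∧ IsGδ H ∧ H.Nonempty ∧ H ⊆ closure S := by
  by_contra! hesc
  obtain ⟨W, _, _, _, hW⟩ := exists_uncountable_wellOrder_countable_Iio
  obtain ⟨x, K, hKc, hxK, hKd⟩ := exists_free_sequence hesc hW
  obtain ⟨q, hq⟩ : (⋂ a, closure (x '' Set.Ici a)).Nonempty := by
    refine IsCompact.nonempty_iInter_of_directed_nonempty_isCompact_isClosed _ ?_
      (fun a => (Set.nonempty_Ici.image x).closure) (fun a => isClosed_closure.isCompact)
      (fun a => isClosed_closure)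
    exact directed_of_isDirected_le fun a b hab =>
      closure_mono (Set.image_mono (Set.Ici_subset_Ici.2 hab))
  rw [Set.mem_iInter] at hq
  have hqr : q ∈ closure (Set.range x) :=
    closure_mono (Set.image_subset_range _ _) (hq (Classical.arbitrary W))
  obtain ⟨B, hBx, hBc, hqB⟩ := tight _ q hqr
  obtain ⟨C, hCc, rfl⟩ : ∃ C : Set W, C.Countable ∧ x '' C = B := by
    choose! c hc using hBx
    refine ⟨c '' B, hBc.image c, ?_⟩
    rw [Set.image_image, Set.image_congr hc, Set.image_id']
  obtain ⟨a, ha⟩ : ∃ a, C ⊆ Set.Iio a := by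
    by_contra! hub
    refine Set.not_countable_univ (α := W) ((hCc.biUnion (t := fun c _ => Set.Iic c)
      fun c _ => ?_).mono fun a _ => ?_)
    · rw [← Set.Iio_insert]
      exact (hW c).insert c
    · obtain ⟨c, hcC, hca⟩ := Set.not_subset.1 (hub a)
      exact Set.mem_biUnion hcC (not_lt.1 hca)
  refine Set.disjoint_left.1 (hKd a) ?_ (closure_mono (Set.image_mono ha) hqB)
  refine closure_minimal ?_ (hKc a) (hq a)
  rintro _ ⟨b, hb, rfl⟩
  exact hxK a b hb

/-- A nonempty compact Hausdorff space of countable tightness has a point of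
character at most 2^ℵ₀. -/
theorem exists_point_character_le_continuum
    (X : Type*) [TopologicalSpace X] [CompactSpace X] [T2Space X] [Nonempty X]
    (tight : ∀ (A : Set X) (x : X), x ∈ closure A →
      ∃ B ⊆ A, B.Countable ∧ x ∈ closure B) :
    ∃ x : X, ∃ B : Set (Set X), Cardinal.mk B ≤ 2 ^ Cardinal.aleph0 ∧
      (∀ s ∈ B, s ∈ 𝓝 x) ∧ (∀ s ∈ 𝓝 x, ∃ t ∈ B, t ⊆ s) := by
  obtain ⟨S, H, hS, -, hH, ⟨x, hx⟩, hHS⟩ := exists_isGδ_subset_closure_countable tight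
  exact ⟨x, exists_nhds_basis_of_isGδ_subset_closure hS hH hHS hx⟩
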